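/- Suppose β > β₂ = e^{λ_max(A)}. Then the upper bounding graph ψ⁺_β is globally attracting away from the zero section: lim_{n→∞} (F^n_{β,θ,α}(r) − ψ⁺_β(g^n(θ,α))) = 0 for every (θ,α,r) ∈ Θ×𝕋×(0,∞). -/

import Mathlib

open Filter MeasureTheory Metric Set
open scoped Topology

noncomputable section

/-- ℝ² with the Euclidean norm. -/
abbrev R2 : Type := EuclideanSpace ℝ (Fin 2)

/-- Action of a 2×2 real matrix on Euclidean ℝ². -/
def mulVecE (M : Matrix (Fin 2) (Fin 2) ℝ) (v : R2) : R2 :=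
  (WithLp.equiv 2 (Fin 2 → ℝ)).symm (M.mulVec ((WithLp.equiv 2 (Fin 2 → ℝ)) v))

/-- Operator norm of a 2×2 real matrix induced by the Euclidean norm on ℝ². -/
def opNorm (M : Matrix (Fin 2) (Fin 2) ℝ) : ℝ :=
  ‖(Matrix.toEuclideanCLM (𝕜 := ℝ) M : R2 →L[ℝ] R2)‖

/-- The cocycle `A_n(θ) = A(γ^{n-1}θ) ⋯ A(θ)`. -/
def coc {Θ : Type*} (γ : Θ → Θ) (A : Θ → Matrix (Fin 2) (Fin 2) ℝ) :
    ℕ → Θ → Matrix (Fin 2) (Fin 2) ℝ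
  | 0, _ => 1
  | n + 1, θ => coc γ A n (γ θ) * A θ

/-- Maximal Lyapunov exponent `λ_max(A) = sup_θ limsup (1/n) log‖A_n(θ)‖`. -/
def lyapMax {Θ : Type*} (γ : Θ → Θ) (A : Θ → Matrix (Fin 2) (Fin 2) ℝ) : ℝ :=
  ⨆ θ : Θ, Filter.limsup (fun n : ℕ => Real.log (opNorm (coc γ A n θ)) / n) Filter.atTop

/-- The hypotheses on `h`: C² on [0,∞), strictly increasing, strictly concave, bounded,
nonnegative, `h 0 = 0`, `h' 0 = 1`. -/
def GoodH (h : ℝ → ℝ) : Prop :=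
  ContDiffOn ℝ 2 h (Set.Ici 0) ∧ StrictMonoOn h (Set.Ici 0) ∧
    StrictConcaveOn ℝ (Set.Ici 0) h ∧ BddAbove (h '' Set.Ici 0) ∧
    (∀ x ∈ Set.Ici (0 : ℝ), 0 ≤ h x) ∧ h 0 = 0 ∧ derivWithin h (Set.Ici 0) 0 = 1

/-- The scaling condition `sup_{x ≥ 0} h(x) ≤ (sup_θ ‖A(θ)‖)⁻¹`. -/
def Scaled {Θ : Type*} (A : Θ → Matrix (Fin 2) (Fin 2) ℝ) (h : ℝ → ℝ) : Prop :=
  ∀ x ∈ Set.Ici (0 : ℝ), h x ≤ (⨆ θ : Θ, opNorm (A θ))⁻¹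

open scoped Classical in
/-- The fibre maps `f_{β,θ}(v) = h(β‖v‖)·A(θ)·v/‖v‖`, `f_{β,θ}(0) = 0`. -/
def fibMap {Θ : Type*} (A : Θ → Matrix (Fin 2) (Fin 2) ℝ) (h : ℝ → ℝ) (β : ℝ)
    (θ : Θ) (v : R2) : R2 :=
  if v = 0 then 0 else (h (β * ‖v‖) / ‖v‖) • mulVecE (A θ) v

/-- The skew product `f_β(θ,v) = (γθ, f_{β,θ}(v))`. -/
def skewProd {Θ : Type*} (γ : Θ → Θ) (A : Θ → Matrix (Fin 2) (Fin 2) ℝ) (h : ℝ → ℝ)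
    (β : ℝ) : Θ × R2 → Θ × R2 :=
  fun p => (γ p.1, fibMap A h β p.1 p.2)

/-- The global attractor `𝒜_β = ⋂_{n∈ℕ} f_β^n(Θ × B̄₁(0))`. -/
def globalAttractor {Θ : Type*} (γ : Θ → Θ) (A : Θ → Matrix (Fin 2) (Fin 2) ℝ)
    (h : ℝ → ℝ) (β : ℝ) : Set (Θ × R2) :=
  ⋂ n : ℕ, (skewProd γ A h β)^[n] '' (Set.univ ×ˢ Metric.closedBall (0 : R2) 1)

/-- The fibre `𝒜_β(θ) = {x : (θ,x) ∈ 𝒜_β}` of the global attractor. -/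
def attractorFib {Θ : Type*} (γ : Θ → Θ) (A : Θ → Matrix (Fin 2) (Fin 2) ℝ)
    (h : ℝ → ℝ) (β : ℝ) (θ : Θ) : Set R2 :=
  {x : R2 | (θ, x) ∈ globalAttractor γ A h β}

/-- `v(α) = (cos 2πα, sin 2πα)ᵗ`. -/
def vFull (α : ℝ) : R2 :=
  (WithLp.equiv 2 (Fin 2 → ℝ)).symm ![Real.cos (2 * Real.pi * α), Real.sin (2 * Real.pi * α)]

/-- `(cos πα, sin πα)ᵗ`, representing the projective point `α ∈ 𝕋 ≅ ℝP¹`. -/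
def vHalf (α : ℝ) : R2 :=
  (WithLp.equiv 2 (Fin 2 → ℝ)).symm ![Real.cos (Real.pi * α), Real.sin (Real.pi * α)]

/-- The projective angle coordinate `p(w) = (1/π)·arg(w) mod 1 ∈ [0,1)` of a nonzero
vector `w ∈ ℝ²`; for `w ≠ 0` this equals `(1/π)·arctan(w₂/w₁) mod 1`. -/
def projAngle (w : R2) : ℝ :=
  Int.fract (Complex.arg (Complex.ofReal (w 0) + Complex.ofReal (w 1) * Complex.I) / Real.pi)

/-- The projective action `g(θ,α) = (γθ, g_θ(α))` of the cocycle on `Θ × 𝕋`,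
where `𝕋` is modelled by the fundamental domain `[0,1) ⊆ ℝ`. -/
def gMap {Θ : Type*} (γ : Θ → Θ) (A : Θ → Matrix (Fin 2) (Fin 2) ℝ) :
    Θ × ℝ → Θ × ℝ :=
  fun p => (γ p.1, projAngle (mulVecE (A p.1) (vHalf p.2)))

/-- `Ω(θ,α) = ‖A(θ)(cos πα, sin πα)ᵗ‖`. -/
def Omega {Θ : Type*} (A : Θ → Matrix (Fin 2) (Fin 2) ℝ) (p : Θ × ℝ) : ℝ :=
  ‖mulVecE (A p.1) (vHalf p.2)‖

/-- The fibre maps `F_{β,θ,α}(r) = h(βr)·Ω(θ,α)` of the double skew product. -/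
def dsFib {Θ : Type*} (A : Θ → Matrix (Fin 2) (Fin 2) ℝ) (h : ℝ → ℝ) (β : ℝ)
    (p : Θ × ℝ) (r : ℝ) : ℝ :=
  h (β * r) * Omega A p

/-- The double skew product `F_β(θ,α,r) = (g(θ,α), h(βr)·Ω(θ,α))` on `Θ × 𝕋 × [0,∞)`. -/
def dsMap {Θ : Type*} (γ : Θ → Θ) (A : Θ → Matrix (Fin 2) (Fin 2) ℝ) (h : ℝ → ℝ)
    (β : ℝ) : Θ × ℝ × ℝ → Θ × ℝ × ℝ :=
  fun p => ((gMap γ A (p.1, p.2.1)).1, (gMap γ A (p.1, p.2.1)).2, dsFib A h β (p.1, p.2.1) p.2.2)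

/-- `Ω_n(θ,α) = ∏_{i=0}^{n-1} Ω(g^i(θ,α))`. -/
def OmegaProd {Θ : Type*} (γ : Θ → Θ) (A : Θ → Matrix (Fin 2) (Fin 2) ℝ) (n : ℕ)
    (p : Θ × ℝ) : ℝ :=
  ∏ i ∈ Finset.range n, Omega A ((gMap γ A)^[i] p)

/-- `Γ(a,b) = inf_{a ≤ x ≤ 1} inf_{0 < q ≤ b} h(qx)/(q·h(x))`. -/
def GammaH (h : ℝ → ℝ) (a b : ℝ) : ℝ :=
  sInf {y : ℝ | ∃ x ∈ Set.Icc a 1, ∃ q ∈ Set.Ioc (0 : ℝ) b, y = h (q * x) / (q * h x)}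

/-- The inverse `g⁻¹(θ,α) = (γ⁻¹θ, projective angle of A(γ⁻¹θ)⁻¹·v(α))` of the
projective action. -/
def gInv {Θ : Type*} (γinv : Θ → Θ) (A : Θ → Matrix (Fin 2) (Fin 2) ℝ) :
    Θ × ℝ → Θ × ℝ :=
  fun p => (γinv p.1, projAngle (mulVecE (A (γinv p.1))⁻¹ (vHalf p.2)))

/-- `F^n_{β,g^{-n}(θ,α)}(1)`, the pullback iterate defining the upper bounding graph. -/
def pullback1 {Θ : Type*} (γ : Θ → Θ) (γinv : Θ → Θ) (A : Θ → Matrix (Fin 2) (Fin 2) ℝ)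
    (h : ℝ → ℝ) (β : ℝ) (n : ℕ) (p : Θ × ℝ) : ℝ :=
  ((dsMap γ A h β)^[n] (((gInv γinv A)^[n] p).1, ((gInv γinv A)^[n] p).2, 1)).2.2

lemma toEuclideanCLM_apply_eq_mulVecE (M : Matrix (Fin 2) (Fin 2) ℝ) (v : R2) :
    (Matrix.toEuclideanCLM (𝕜 := ℝ) M : R2 →L[ℝ] R2) v = mulVecE M v := rfl

lemma mulVecE_smul (M : Matrix (Fin 2) (Fin 2) ℝ) (c : ℝ) (v : R2) :
    mulVecE M (c • v) = c • mulVecE M v := by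
  simp [← toEuclideanCLM_apply_eq_mulVecE]

lemma mulVecE_neg (M : Matrix (Fin 2) (Fin 2) ℝ) (v : R2) :
    mulVecE M (-v) = -mulVecE M v := by
  simp [← toEuclideanCLM_apply_eq_mulVecE]

lemma mulVecE_mul (M N : Matrix (Fin 2) (Fin 2) ℝ) (v : R2) :
    mulVecE (M * N) v = mulVecE M (mulVecE N v) := by
  simp [← toEuclideanCLM_apply_eq_mulVecE]

lemma mulVecE_one (v : R2) : mulVecE 1 v = v := by
  simp [← toEuclideanCLM_apply_eq_mulVecE]

lemma norm_mulVecE_le (M : Matrix (Fin 2) (Fin 2) ℝ) (v : R2) :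
    ‖mulVecE M v‖ ≤ opNorm M * ‖v‖ :=
  (Matrix.toEuclideanCLM (𝕜 := ℝ) M : R2 →L[ℝ] R2).le_opNorm v

lemma opNorm_nonneg (M : Matrix (Fin 2) (Fin 2) ℝ) : 0 ≤ opNorm M := norm_nonneg _

lemma opNorm_one : opNorm 1 = 1 := by
  simp [opNorm]

lemma opNorm_mul_le (M N : Matrix (Fin 2) (Fin 2) ℝ) :
    opNorm (M * N) ≤ opNorm M * opNorm N := by
  simpa [opNorm] using norm_mul_le (Matrix.toEuclideanCLM (𝕜 := ℝ) M : R2 →L[ℝ] R2)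
    (Matrix.toEuclideanCLM (𝕜 := ℝ) N : R2 →L[ℝ] R2)

lemma continuous_opNorm : Continuous opNorm :=
  continuous_norm.comp (LinearMap.continuous_of_finiteDimensional
    (Matrix.toEuclideanCLM (n := Fin 2) (𝕜 := ℝ)).toAlgEquiv.toLinearMap)

lemma norm_vHalf (α : ℝ) : ‖vHalf α‖ = 1 := by
  simp [vHalf, EuclideanSpace.norm_eq, Fin.sum_univ_two]

/-- A unimodular matrix contracts no vector by more than its operator norm. -/
lemma norm_le_opNorm_mul_norm_mulVecE {M : Matrix (Fin 2) (Fin 2) ℝ} (hM : M.det = 1) (v : R2) :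
    ‖v‖ ≤ opNorm M * ‖mulVecE M v‖ := by
  rcases eq_or_ne v 0 with rfl | hv
  · simpa using mul_nonneg (opNorm_nonneg M) (norm_nonneg _)
  set w : R2 := !₂[-v 1, v 0] with hw
  have hwv : ‖w‖ = ‖v‖ := by
    simp [hw, EuclideanSpace.norm_eq, Fin.sum_univ_two, add_comm]
  have hin : inner ℝ (!₂[-(mulVecE M v) 1, (mulVecE M v) 0] : R2) (mulVecE M w) = ‖v‖ ^ 2 := by
    rw [Matrix.det_fin_two] at hM
    simp only [EuclideanSpace.norm_sq_eq, Fin.sum_univ_two, PiLp.inner_apply, mulVecE, hw,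
      WithLp.equiv_apply, WithLp.equiv_symm_apply, Matrix.mulVec, dotProduct]
    simp
    linear_combination (v 0 ^ 2 + v 1 ^ 2) * hM
  have hJ : ‖(!₂[-(mulVecE M v) 1, (mulVecE M v) 0] : R2)‖ = ‖mulVecE M v‖ := by
    simp [EuclideanSpace.norm_eq, Fin.sum_univ_two, add_comm]
  have h1 := real_inner_le_norm (!₂[-(mulVecE M v) 1, (mulVecE M v) 0] : R2) (mulVecE M w)
  have h2 := norm_mulVecE_le M w
  rw [hin, hJ] at h1
  rw [hwv] at h2
  have hv' : 0 < ‖v‖ := norm_pos_iff.2 hv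
  nlinarith [norm_nonneg (mulVecE M v), mul_le_mul_of_nonneg_left h2 (norm_nonneg (mulVecE M v))]

lemma one_le_opNorm {M : Matrix (Fin 2) (Fin 2) ℝ} (hM : M.det = 1) : 1 ≤ opNorm M := by
  have h1 := norm_le_opNorm_mul_norm_mulVecE hM (vHalf 0)
  have h2 := norm_mulVecE_le M (vHalf 0)
  rw [norm_vHalf] at h1 h2
  nlinarith [opNorm_nonneg M, mul_le_mul_of_nonneg_left h2 (opNorm_nonneg M)]

lemma mulVecE_ne_zero {M : Matrix (Fin 2) (Fin 2) ℝ} (hM : M.det = 1) {v : R2} (hv : v ≠ 0) :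
    mulVecE M v ≠ 0 := by
  intro h0
  have := norm_le_opNorm_mul_norm_mulVecE hM v
  rw [h0, norm_zero, mul_zero] at this
  exact hv (norm_le_zero_iff.1 this)

lemma vHalf_ne_zero (α : ℝ) : vHalf α ≠ 0 := by
  rw [← norm_ne_zero_iff, norm_vHalf]; exact one_ne_zero

lemma vHalf_fract (x : ℝ) : vHalf (Int.fract x) = vHalf x ∨ vHalf (Int.fract x) = -vHalf x := by
  have hx : Real.pi * Int.fract x = Real.pi * x - ⌊x⌋ * Real.pi := by
    rw [Int.fract]; ring
  rcases Int.even_or_odd ⌊x⌋ with he | ho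
  · left
    ext i
    fin_cases i <;>
      simp [vHalf, hx, Real.cos_sub_int_mul_pi, Real.sin_sub_int_mul_pi, he.neg_one_zpow]
  · right
    ext i
    fin_cases i <;>
      simp [vHalf, hx, Real.cos_sub_int_mul_pi, Real.sin_sub_int_mul_pi, ho.neg_one_zpow]

lemma vHalf_arg_div_pi {w : R2} (hw : w ≠ 0) :
    vHalf (Complex.arg (Complex.ofReal (w 0) + Complex.ofReal (w 1) * Complex.I) / Real.pi) =
      ‖w‖⁻¹ • w := by
  set z : ℂ := Complex.ofReal (w 0) + Complex.ofReal (w 1) * Complex.I with hz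
  have hre : z.re = w 0 := by simp [hz]
  have him : z.im = w 1 := by simp [hz]
  have hn : ‖z‖ = ‖w‖ := by
    rw [Complex.norm_eq_sqrt_sq_add_sq, hre, him]
    simp [EuclideanSpace.norm_eq, Fin.sum_univ_two]
  have hz0 : z ≠ 0 := by
    rw [← norm_ne_zero_iff, hn]; exact norm_ne_zero_iff.2 hw
  have hpi : Real.pi * (z.arg / Real.pi) = z.arg := by field_simp
  ext i
  fin_cases i
  · simp [vHalf, hpi, Complex.cos_arg hz0, hre, hn]; ring
  · simp [vHalf, hpi, Complex.sin_arg, him, hn]; ring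

lemma vHalf_projAngle {w : R2} (hw : w ≠ 0) :
    vHalf (projAngle w) = ‖w‖⁻¹ • w ∨ vHalf (projAngle w) = -(‖w‖⁻¹ • w) := by
  rw [← vHalf_arg_div_pi hw]
  exact vHalf_fract _

/-- Two points of `Θ × ℝ` represent the same point of the projective bundle. -/
def SameLine {Θ : Type*} (p q : Θ × ℝ) : Prop :=
  p.1 = q.1 ∧ (vHalf p.2 = vHalf q.2 ∨ vHalf p.2 = -vHalf q.2)

lemma SameLine.refl {Θ : Type*} (p : Θ × ℝ) : SameLine p p := ⟨rfl, Or.inl rfl⟩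

lemma SameLine.trans {Θ : Type*} {p q r : Θ × ℝ} (h₁ : SameLine p q) (h₂ : SameLine q r) :
    SameLine p r := by
  refine ⟨h₁.1.trans h₂.1, ?_⟩
  rcases h₁.2 with h | h <;> rcases h₂.2 with h' | h' <;> simp [h, h']

lemma vHalf_projAngle_eq_or_neg_of_smul {w : R2} (hw : w ≠ 0) {c : ℝ} {α : ℝ}
    (h : w = c • vHalf α) :
    vHalf (projAngle w) = vHalf α ∨ vHalf (projAngle w) = -vHalf α := by
  have hc : c ≠ 0 := by rintro rfl; simp [h] at hw
  have hn : ‖w‖⁻¹ * c = 1 ∨ ‖w‖⁻¹ * c = -1 := by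
    rw [h, norm_smul, norm_vHalf, mul_one, Real.norm_eq_abs]
    rcases abs_choice c with h' | h' <;> rw [h'] <;> field_simp <;> simp
  have := vHalf_projAngle hw
  rw [show ‖w‖⁻¹ • w = (‖w‖⁻¹ * c) • vHalf α by rw [mul_smul, ← h]] at this
  rcases hn with h' | h' <;> rw [h'] at this <;> simpa [or_comm] using this

section Projective

variable {Θ : Type*} {γ : Θ → Θ} {γinv : Θ → Θ} {A : Θ → Matrix (Fin 2) (Fin 2) ℝ}

lemma SameLine.omega_eq {p q : Θ × ℝ} (h : SameLine p q) : Omega A p = Omega A q := by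
  obtain ⟨h₁, h₂ | h₂⟩ := h <;> simp [Omega, h₁, h₂, mulVecE_neg]

lemma omega_pos (hdet : ∀ θ, (A θ).det = 1) (p : Θ × ℝ) : 0 < Omega A p :=
  norm_pos_iff.2 (mulVecE_ne_zero (hdet _) (vHalf_ne_zero _))

lemma omega_le_opNorm (p : Θ × ℝ) : Omega A p ≤ opNorm (A p.1) := by
  simpa [Omega, norm_vHalf] using norm_mulVecE_le (A p.1) (vHalf p.2)

/-- Nonzero vectors that agree up to sign have the same projective angle up to sign. -/
lemma vHalf_projAngle_congr {w w' : R2} (hw : w' ≠ 0) (h : w = w' ∨ w = -w') :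
    vHalf (projAngle w) = vHalf (projAngle w') ∨
      vHalf (projAngle w) = -vHalf (projAngle w') := by
  have h0 : w ≠ 0 := by rcases h with rfl | rfl <;> simpa using hw
  have h1 := vHalf_projAngle h0
  have h2 := vHalf_projAngle hw
  rcases h with rfl | rfl <;> rcases h1 with h1 | h1 <;> rcases h2 with h2 | h2 <;>
    simp [h1, h2]

lemma SameLine.gMap (hdet : ∀ θ, (A θ).det = 1) {p q : Θ × ℝ} (h : SameLine p q) :
    SameLine (gMap γ A p) (gMap γ A q) := by
  refine ⟨congrArg γ h.1, ?_⟩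
  refine vHalf_projAngle_congr (mulVecE_ne_zero (hdet _) (vHalf_ne_zero _)) ?_
  obtain ⟨h₁, h₂ | h₂⟩ := h <;> simp [h₁, h₂, mulVecE_neg]

lemma det_inv_eq_one {M : Matrix (Fin 2) (Fin 2) ℝ} (hM : M.det = 1) : M⁻¹.det = 1 := by
  rw [Matrix.det_nonsing_inv, hM]; simp

lemma SameLine.gInv (hdet : ∀ θ, (A θ).det = 1) {p q : Θ × ℝ} (h : SameLine p q) :
    SameLine (gInv γinv A p) (gInv γinv A q) := by
  refine ⟨congrArg γinv h.1, ?_⟩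
  refine vHalf_projAngle_congr
    (mulVecE_ne_zero (det_inv_eq_one (hdet _)) (vHalf_ne_zero _)) ?_
  obtain ⟨h₁, h₂ | h₂⟩ := h <;> simp [h₁, h₂, mulVecE_neg]

lemma vHalf_projAngle_mulVecE_projAngle {M N : Matrix (Fin 2) (Fin 2) ℝ} (hM : M.det = 1)
    (hN : N.det = 1) (hMN : M * N = 1) (α : ℝ) :
    vHalf (projAngle (mulVecE M (vHalf (projAngle (mulVecE N (vHalf α)))))) = vHalf α ∨
      vHalf (projAngle (mulVecE M (vHalf (projAngle (mulVecE N (vHalf α)))))) = -vHalf α := by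
  have h0 := mulVecE_ne_zero hM (vHalf_ne_zero (projAngle (mulVecE N (vHalf α))))
  have key : mulVecE M (mulVecE N (vHalf α)) = vHalf α := by
    rw [← mulVecE_mul, hMN, mulVecE_one]
  rcases vHalf_projAngle (mulVecE_ne_zero hN (vHalf_ne_zero α)) with h | h
  · exact vHalf_projAngle_eq_or_neg_of_smul h0 (by rw [h, mulVecE_smul, key])
  · refine vHalf_projAngle_eq_or_neg_of_smul (c := -‖mulVecE N (vHalf α)‖⁻¹) h0 ?_
    rw [h, mulVecE_neg, mulVecE_smul, key, neg_smul]

lemma sameLine_gMap_gInv (hdet : ∀ θ, (A θ).det = 1) (hγ : Function.RightInverse γinv γ)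
    (p : Θ × ℝ) : SameLine (gMap γ A (gInv γinv A p)) p :=
  ⟨hγ p.1, vHalf_projAngle_mulVecE_projAngle (hdet _) (det_inv_eq_one (hdet _))
    (Matrix.mul_nonsing_inv _ (by simp [hdet])) p.2⟩

lemma sameLine_gInv_gMap (hdet : ∀ θ, (A θ).det = 1) (hγ : Function.LeftInverse γinv γ)
    (p : Θ × ℝ) : SameLine (gInv γinv A (gMap γ A p)) p := by
  refine ⟨hγ p.1, ?_⟩
  have := vHalf_projAngle_mulVecE_projAngle (det_inv_eq_one (hdet p.1)) (hdet p.1)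
    (Matrix.nonsing_inv_mul _ (by simp [hdet])) p.2
  simpa only [_root_.gInv, _root_.gMap, hγ p.1] using this

lemma SameLine.iterate {f : Θ × ℝ → Θ × ℝ} (hf : ∀ p q, SameLine p q → SameLine (f p) (f q))
    {p q : Θ × ℝ} (h : SameLine p q) (n : ℕ) : SameLine (f^[n] p) (f^[n] q) := by
  induction n with
  | zero => exact h
  | succ n ih => simpa only [Function.iterate_succ_apply'] using hf _ _ ih

lemma sameLine_gMap_iterate_gInv_iterate (hdet : ∀ θ, (A θ).det = 1)
    (hγ : Function.RightInverse γinv γ) (n : ℕ) (p : Θ × ℝ) :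
    SameLine ((gMap γ A)^[n] ((gInv γinv A)^[n] p)) p := by
  induction n with
  | zero => exact .refl p
  | succ n ih =>
    rw [Function.iterate_succ_apply, Function.iterate_succ_apply' (gInv γinv A)]
    exact (SameLine.iterate (fun _ _ h => h.gMap hdet)
      (sameLine_gMap_gInv hdet hγ _) n).trans ih

/-- The product of the expansion factors along a projective orbit is the growth of the vector. -/
lemma omegaProd_eq_norm (hdet : ∀ θ, (A θ).det = 1) (n : ℕ) (p : Θ × ℝ) :
    OmegaProd γ A n p = ‖mulVecE (coc γ A n p.1) (vHalf p.2)‖ := by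
  induction n generalizing p with
  | zero => simp [OmegaProd, coc, mulVecE_one, norm_vHalf]
  | succ n ih =>
    have h0 := mulVecE_ne_zero (hdet p.1) (vHalf_ne_zero p.2)
    have h1 : OmegaProd γ A (n + 1) p = OmegaProd γ A n (gMap γ A p) * Omega A p := by
      simp [OmegaProd, Finset.prod_range_succ']
    rw [h1, ih, coc, mulVecE_mul, Omega]
    have hpos : ‖mulVecE (A p.1) (vHalf p.2)‖ ≠ 0 := norm_ne_zero_iff.2 h0
    rcases vHalf_projAngle h0 with h | h <;>
      simp only [gMap, h, mulVecE_neg, mulVecE_smul, norm_neg, norm_smul, norm_inv, norm_norm] <;>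
      field_simp

lemma det_coc (hdet : ∀ θ, (A θ).det = 1) (n : ℕ) (θ : Θ) : (coc γ A n θ).det = 1 := by
  induction n generalizing θ with
  | zero => simp [coc]
  | succ n ih => simp [coc, ih, hdet]

lemma coc_add (m n : ℕ) (θ : Θ) : coc γ A (m + n) θ = coc γ A m (γ^[n] θ) * coc γ A n θ := by
  induction n generalizing θ with
  | zero => simp [coc]
  | succ n ih => rw [← add_assoc, coc, ih, coc, Function.iterate_succ_apply, mul_assoc]

end Projective

lemma GoodH.continuousOn {h : ℝ → ℝ} (hh : GoodH h) : ContinuousOn h (Ici 0) := hh.1.continuousOn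

lemma GoodH.pos {h : ℝ → ℝ} (hh : GoodH h) {x : ℝ} (hx : 0 < x) : 0 < h x := by
  have := hh.2.1 (mem_Ici.2 le_rfl) (mem_Ici.2 hx.le) hx
  rwa [hh.2.2.2.2.2.1] at this

lemma GoodH.mul_le {h : ℝ → ℝ} (hh : GoodH h) {q x : ℝ} (hq₀ : 0 ≤ q) (hq₁ : q ≤ 1)
    (hx : 0 ≤ x) : q * h x ≤ h (q * x) := by
  have := hh.2.2.1.concaveOn.2 (mem_Ici.2 hx) (mem_Ici.2 le_rfl) hq₀ (sub_nonneg.2 hq₁)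
    (by ring)
  simpa [hh.2.2.2.2.2.1] using this

lemma GoodH.mul_lt {h : ℝ → ℝ} (hh : GoodH h) {q x : ℝ} (hq₀ : 0 < q) (hq₁ : q < 1)
    (hx : 0 < x) : q * h x < h (q * x) := by
  have := hh.2.2.1.2 (mem_Ici.2 hx.le) (mem_Ici.2 le_rfl) hx.ne' hq₀ (sub_pos.2 hq₁)
    (by ring)
  simpa [hh.2.2.2.2.2.1] using this

/-- Away from a neighbourhood of `0` the map `h` is bounded below, near `0` it is almost the
identity. -/
lemma GoodH.exists_min_le {h : ℝ → ℝ} (hh : GoodH h) {s : ℝ} (hs : s < 1) :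
    ∃ c > 0, ∀ x, 0 ≤ x → min (s * x) c ≤ h x := by
  have hd : HasDerivWithinAt h 1 (Ici 0) 0 := by
    have := ((hh.1.differentiableOn (by norm_num)) 0 (mem_Ici.2 le_rfl)).hasDerivWithinAt
    rwa [hh.2.2.2.2.2.2] at this
  have ht := (hasDerivWithinAt_iff_tendsto_slope' (s := Ioi 0) (by simp)).1 hd.Ioi_of_Ici
  obtain ⟨t, ht, htpos⟩ := ((ht.eventually (lt_mem_nhds hs)).and self_mem_nhdsWithin).exists
  have htpos : 0 < t := htpos
  rw [slope_def_field, hh.2.2.2.2.2.1, sub_zero, sub_zero, lt_div_iff₀ htpos] at ht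
  refine ⟨h t, hh.pos htpos, fun x hx => ?_⟩
  rcases le_total x t with hxt | hxt
  · refine (min_le_left _ _).trans ?_
    have h1 := hh.mul_le (div_nonneg hx htpos.le) ((div_le_one htpos).2 hxt) htpos.le
    rw [div_mul_cancel₀ _ htpos.ne'] at h1
    refine le_trans ?_ h1
    rw [div_mul_eq_mul_div, le_div_iff₀ htpos]
    nlinarith
  · exact (min_le_right _ _).trans
      (hh.2.1.monotoneOn (mem_Ici.2 htpos.le) (mem_Ici.2 hx) hxt)

/-- Two positive ordered orbits of the nonautonomous system `x ↦ h (β x) ω n` are asymptotic. -/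
lemma GoodH.tendsto_sub_of_le {h : ℝ → ℝ} (hh : GoodH h) {β B : ℝ} (hβ : 0 < β)
    {ω a b : ℕ → ℝ} (hω : ∀ n, 0 < ω n) (ha : ∀ n, a (n + 1) = h (β * a n) * ω n)
    (hb : ∀ n, b (n + 1) = h (β * b n) * ω n) (ha₀ : 0 < a 0) (hab : a 0 ≤ b 0)
    (hB : ∀ n, b n ≤ B) : Tendsto (fun n => b n - a n) atTop (𝓝 0) := by
  have hpos : ∀ n, 0 < a n := by
    intro n
    induction n with
    | zero => exact ha₀
    | succ n ih => rw [ha]; exact mul_pos (hh.pos (mul_pos hβ ih)) (hω n)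
  have hle : ∀ n, a n ≤ b n := by
    intro n
    induction n with
    | zero => exact hab
    | succ n ih =>
      rw [ha, hb]
      refine mul_le_mul_of_nonneg_right (hh.2.1.monotoneOn (mem_Ici.2 ?_) (mem_Ici.2 ?_) ?_)
        (hω n).le
      · exact (mul_pos hβ (hpos n)).le
      · exact (mul_pos hβ ((hpos n).trans_le ih)).le
      · gcongr
  have hbpos : ∀ n, 0 < b n := fun n => (hpos n).trans_le (hle n)
  set q : ℕ → ℝ := fun n => a n / b n with hq
  have hqpos : ∀ n, 0 < q n := fun n => div_pos (hpos n) (hbpos n)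
  have hq1 : ∀ n, q n ≤ 1 := fun n => (div_le_one (hbpos n)).2 (hle n)
  have haq : ∀ n, a n = q n * b n := fun n => (div_mul_cancel₀ _ (hbpos n).ne').symm
  have hstep : ∀ n, q (n + 1) = h (q n * (β * b n)) / h (β * b n) := by
    intro n
    simp only [hq]
    rw [ha, hb, mul_div_mul_right _ _ (hω n).ne']
    congr 2
    have := (hbpos n).ne'
    field_simp
  have hmono : Monotone q := by
    refine monotone_nat_of_le_succ fun n => ?_
    rw [hstep, le_div_iff₀ (hh.pos (mul_pos hβ (hbpos n)))]
    exact hh.mul_le (hqpos n).le (hq1 n) (mul_pos hβ (hbpos n)).le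
  obtain ⟨l, hl⟩ : ∃ l, Tendsto q atTop (𝓝 l) :=
    ⟨_, tendsto_atTop_ciSup hmono ⟨1, by rintro _ ⟨n, rfl⟩; exact hq1 n⟩⟩
  have hql : ∀ n, q n ≤ l := hmono.ge_of_tendsto hl
  have hl1 : l ≤ 1 := le_of_tendsto' hl hq1
  rcases hl1.eq_or_lt with rfl | hl1
  · have hlim : Tendsto (fun n => B * (1 - q n)) atTop (𝓝 0) := by
      simpa using (hl.const_sub 1).const_mul B
    refine squeeze_zero (fun n => sub_nonneg.2 (hle n)) (fun n => ?_) hlim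
    have : b n - a n = b n * (1 - q n) := by rw [haq n]; ring
    rw [this]
    exact mul_le_mul_of_nonneg_right (hB n) (sub_nonneg.2 (hq1 n))
  suffices hb0 : Tendsto b atTop (𝓝 0) from
    squeeze_zero (fun n => sub_nonneg.2 (hle n))
      (fun n => sub_le_self _ (hpos n).le) hb0
  by_contra hcon
  obtain ⟨ε, hε, hfreq⟩ : ∃ ε > 0, ∃ᶠ n in atTop, ε ≤ b n := by
    rw [Metric.tendsto_nhds] at hcon
    push Not at hcon
    obtain ⟨ε, hε, hf⟩ := hcon
    refine ⟨ε, hε, hf.mono fun n hn => ?_⟩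
    simpa [Real.dist_eq, abs_of_pos (hbpos n)] using hn
  set K : Set (ℝ × ℝ) := Icc (q 0) l ×ˢ Icc ε B with hK
  have hKc : IsCompact K := isCompact_Icc.prod isCompact_Icc
  have hmem : ∀ n, ε ≤ b n → (q n, b n) ∈ K := fun n hn =>
    ⟨⟨hmono (Nat.zero_le n), hql n⟩, hn, hB n⟩
  have hKne : K.Nonempty := by
    obtain ⟨n, hn⟩ := hfreq.exists
    exact ⟨_, hmem n hn⟩
  set φ : ℝ × ℝ → ℝ := fun p => h (p.1 * (β * p.2)) - p.1 * h (β * p.2) with hφ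
  have hK0 : ∀ p ∈ K, 0 < p.1 ∧ 0 < p.2 := fun p hp =>
    ⟨(hqpos 0).trans_le hp.1.1, hε.trans_le hp.2.1⟩
  have hφc : ContinuousOn φ K := by
    refine ContinuousOn.sub ?_ (continuousOn_fst.mul ?_)
    · refine hh.continuousOn.comp (by fun_prop) fun p hp => mem_Ici.2 ?_
      obtain ⟨h1, h2⟩ := hK0 p hp
      positivity
    · refine hh.continuousOn.comp (by fun_prop) fun p hp => mem_Ici.2 ?_
      have := (hK0 p hp).2
      positivity
  obtain ⟨p, hp, hpmin⟩ := hKc.exists_isMinOn hKne hφc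
  have hφp : 0 < φ p := sub_pos.2 (hh.mul_lt (hK0 p hp).1 (hp.1.2.trans_lt hl1)
    (mul_pos hβ (hK0 p hp).2))
  have hBpos : 0 < B := (hbpos 0).trans_le (hB 0)
  have hhB : 0 < h (β * B) := hh.pos (mul_pos hβ hBpos)
  have hdiff : Tendsto (fun n => q (n + 1) - q n) atTop (𝓝 0) := by
    simpa using ((tendsto_add_atTop_iff_nat 1).2 hl).sub hl
  have hsmall := hdiff.eventually (gt_mem_nhds (div_pos hφp hhB))
  obtain ⟨n, hn, hlt⟩ := (hfreq.and_eventually hsmall).exists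
  refine absurd hlt (not_lt.2 ?_)
  have hhb : 0 < h (β * b n) := hh.pos (mul_pos hβ (hbpos n))
  have hφn : φ p ≤ φ (q n, b n) := hpmin (hmem n hn)
  have heq : q (n + 1) - q n = φ (q n, b n) / h (β * b n) := by
    rw [hstep, hφ]; field_simp
  rw [heq]
  refine div_le_div₀ (hφp.le.trans hφn) hφn hhb
    (hh.2.1.monotoneOn (mem_Ici.2 (mul_pos hβ (hbpos n)).le) (mem_Ici.2 (mul_pos hβ hBpos).le) ?_)
  exact mul_le_mul_of_nonneg_left (hB n) hβ.le

lemma continuous_coc {Θ : Type*} [TopologicalSpace Θ] {γ : Θ → Θ}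
    {A : Θ → Matrix (Fin 2) (Fin 2) ℝ} (hγ : Continuous γ) (hA : Continuous A) (n : ℕ) : Continuous (coc γ A n) := by
  induction n with
  | zero => exact continuous_const
  | succ n ih => exact (ih.comp hγ).matrix_mul hA

section Cocycle

variable {Θ : Type*} [MetricSpace Θ] [CompactSpace Θ] {γ : Θ → Θ}
  {A : Θ → Matrix (Fin 2) (Fin 2) ℝ}

lemma bddAbove_range_opNorm (hA : Continuous A) : BddAbove (range fun θ => opNorm (A θ)) :=
  (isCompact_range (continuous_opNorm.comp hA)).bddAbove

lemma exists_opNorm_coc_le_pow (hA : Continuous A) :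
    ∃ K : ℝ, 1 ≤ K ∧ ∀ n θ, opNorm (coc γ A n θ) ≤ K ^ n := by
  obtain ⟨K, hK⟩ := bddAbove_range_opNorm hA
  refine ⟨max K 1, le_max_right _ _, fun n => ?_⟩
  induction n with
  | zero => simp [coc, opNorm_one]
  | succ n ih =>
    intro θ
    rw [coc, pow_succ]
    exact (opNorm_mul_le _ _).trans (mul_le_mul (ih _)
      ((hK ⟨θ, rfl⟩).trans (le_max_left _ _)) (opNorm_nonneg _) (by positivity))

lemma limsup_log_opNorm_coc_le_lyapMax (hdet : ∀ θ, (A θ).det = 1) (hA : Continuous A) (θ : Θ) :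
    IsBoundedUnder (· ≤ ·) atTop (fun n : ℕ => Real.log (opNorm (coc γ A n θ)) / n) ∧
    limsup (fun n : ℕ => Real.log (opNorm (coc γ A n θ)) / n) atTop ≤ lyapMax γ A := by
  obtain ⟨K, hK1, hK⟩ := exists_opNorm_coc_le_pow (γ := γ) hA
  have hle : ∀ (θ : Θ) (n : ℕ), Real.log (opNorm (coc γ A n θ)) / n ≤ Real.log K := by
    intro θ n
    rcases Nat.eq_zero_or_pos n with rfl | hn
    · simpa using Real.log_nonneg hK1
    rw [div_le_iff₀ (by exact_mod_cast hn), mul_comm, ← Real.log_pow]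
    exact Real.log_le_log (one_pos.trans_le (one_le_opNorm (det_coc hdet n θ))) (hK n θ)
  have hge : ∀ (θ : Θ) (n : ℕ), 0 ≤ Real.log (opNorm (coc γ A n θ)) / n := fun θ n =>
    div_nonneg (Real.log_nonneg (one_le_opNorm (det_coc hdet n θ))) n.cast_nonneg
  refine ⟨isBoundedUnder_of ⟨_, hle θ⟩, ?_⟩
  refine le_ciSup (f := fun θ => limsup
    (fun n : ℕ => Real.log (opNorm (coc γ A n θ)) / n) atTop) ⟨Real.log K, ?_⟩ θ
  rintro _ ⟨θ', rfl⟩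
  exact limsup_le_of_le (IsBoundedUnder.isCoboundedUnder_le (isBoundedUnder_of ⟨0, hge θ'⟩))
    (Eventually.of_forall (hle θ'))

/-- The growth rate of the cocycle is uniformly bounded by any number above `e^{λ_max}`. -/
lemma exists_opNorm_coc_le_mul_pow (hγ : Continuous γ) (hdet : ∀ θ, (A θ).det = 1)
    (hA : Continuous A) {ρ : ℝ} (hρ : Real.exp (lyapMax γ A) < ρ) :
    ∃ C > 0, ∀ n θ, opNorm (coc γ A n θ) ≤ C * ρ ^ n := by
  have hρ0 : 0 < ρ := (Real.exp_pos _).trans hρ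
  have hpt : ∀ θ, ∃ m, opNorm (coc γ A (m + 1) θ) < ρ ^ (m + 1) := by
    intro θ
    obtain ⟨hb, hl⟩ := limsup_log_opNorm_coc_le_lyapMax (γ := γ) hdet hA θ
    have hlt := eventually_lt_of_limsup_lt (hl.trans_lt ((Real.lt_log_iff_exp_lt hρ0).2 hρ)) hb
    obtain ⟨n, hn, hn1⟩ := (hlt.and (eventually_ge_atTop 1)).exists
    obtain ⟨m, rfl⟩ := Nat.exists_eq_add_of_le' hn1
    refine ⟨m, ?_⟩
    rw [div_lt_iff₀ (by positivity), mul_comm, ← Real.log_pow] at hn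
    exact (Real.log_lt_log_iff (one_pos.trans_le (one_le_opNorm (det_coc hdet _ θ)))
      (by positivity)).1 hn
  obtain ⟨t, ht⟩ := isCompact_univ.elim_finite_subcover
    (fun m : ℕ => {θ | opNorm (coc γ A (m + 1) θ) < ρ ^ (m + 1)})
    (fun m => isOpen_lt (continuous_opNorm.comp (continuous_coc hγ hA _)) continuous_const)
    (fun θ _ => mem_iUnion.2 (hpt θ))
  obtain ⟨M, hM⟩ : ∃ M, ∀ m ∈ t, m < M := ⟨t.sup id + 1, fun m hm =>
    Nat.lt_succ_of_le (Finset.le_sup (f := id) hm)⟩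
  obtain ⟨K, hK1, hK⟩ := exists_opNorm_coc_le_pow (γ := γ) hA
  have hKρ : 0 < K / ρ := div_pos (one_pos.trans_le hK1) hρ0
  set C : ℝ := ∑ n ∈ Finset.range (M + 1), (K / ρ) ^ n with hC
  refine ⟨C, Finset.sum_pos (fun n _ => by positivity) ⟨0, by simp⟩, fun n => ?_⟩
  induction n using Nat.strong_induction_on with
  | _ n ih =>
    intro θ
    rcases lt_or_ge n (M + 1) with hn | hn
    · have h1 : (K / ρ) ^ n ≤ C := Finset.single_le_sum
        (f := fun n => (K / ρ) ^ n) (fun i _ => by positivity) (Finset.mem_range.2 hn)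
      refine (hK n θ).trans ?_
      rwa [div_pow, div_le_iff₀ (by positivity)] at h1
    · obtain ⟨m, hm⟩ := mem_iUnion.1 (ht (mem_univ θ))
      obtain ⟨hmt, hm⟩ := mem_iUnion.1 hm
      have hmM := hM m hmt
      have hsplit : n = (n - (m + 1)) + (m + 1) := by omega
      rw [hsplit, coc_add, pow_add, ← mul_assoc]
      exact (opNorm_mul_le _ _).trans (mul_le_mul (ih _ (by omega) _) (le_of_lt hm)
        (opNorm_nonneg _) ((opNorm_nonneg _).trans (ih (n - (m + 1)) (by omega) θ)))

lemma Scaled.mul_omega_le_one {h : ℝ → ℝ} (hs : Scaled A h) (hdet : ∀ θ, (A θ).det = 1)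
    (hA : Continuous A) {x : ℝ} (hx : 0 ≤ x) (p : Θ × ℝ) : h x * Omega A p ≤ 1 := by
  have h1 : opNorm (A p.1) ≤ ⨆ θ, opNorm (A θ) := le_ciSup (bddAbove_range_opNorm hA) p.1
  have h2 : 0 < ⨆ θ, opNorm (A θ) := one_pos.trans_le ((one_le_opNorm (hdet p.1)).trans h1)
  calc h x * Omega A p ≤ (⨆ θ, opNorm (A θ))⁻¹ * ⨆ θ, opNorm (A θ) :=
        mul_le_mul (hs x hx) ((omega_le_opNorm p).trans h1) (norm_nonneg _) (inv_nonneg.2 h2.le)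
    _ = 1 := inv_mul_cancel₀ h2.ne'

end Cocycle

section Orbits

variable {Θ : Type*} {γ : Θ → Θ} {γinv : Θ → Θ} {A : Θ → Matrix (Fin 2) (Fin 2) ℝ}
  {h : ℝ → ℝ} {β : ℝ}

/-- The fibre component `F^n_{β,p}(r)` of an orbit of the double skew product. -/
def fibOrbit (γ : Θ → Θ) (A : Θ → Matrix (Fin 2) (Fin 2) ℝ) (h : ℝ → ℝ) (β : ℝ)
    (p : Θ × ℝ) (r : ℝ) (n : ℕ) : ℝ :=
  ((dsMap γ A h β)^[n] (p.1, p.2, r)).2.2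

lemma fibOrbit_zero (p : Θ × ℝ) (r : ℝ) : fibOrbit γ A h β p r 0 = r := rfl

lemma fibOrbit_succ' (p : Θ × ℝ) (r : ℝ) (n : ℕ) :
    fibOrbit γ A h β p r (n + 1) =
      fibOrbit γ A h β (gMap γ A p) (h (β * r) * Omega A p) n := rfl

lemma fibOrbit_succ (p : Θ × ℝ) (r : ℝ) (n : ℕ) :
    fibOrbit γ A h β p r (n + 1) =
      h (β * fibOrbit γ A h β p r n) * Omega A ((gMap γ A)^[n] p) := by
  induction n generalizing p r with
  | zero => rfl
  | succ n ih => rw [fibOrbit_succ', ih, ← fibOrbit_succ', Function.iterate_succ_apply]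

lemma SameLine.fibOrbit_eq (hdet : ∀ θ, (A θ).det = 1) {p q : Θ × ℝ} (hpq : SameLine p q)
    (r : ℝ) (n : ℕ) : fibOrbit γ A h β p r n = fibOrbit γ A h β q r n := by
  induction n with
  | zero => rfl
  | succ n ih =>
    rw [fibOrbit_succ, fibOrbit_succ, ih,
      (SameLine.iterate (fun _ _ h => h.gMap hdet) hpq n).omega_eq]

lemma fibOrbit_nonneg (hh : GoodH h) (hβ : 0 ≤ β) (p : Θ × ℝ) {r : ℝ} (hr : 0 ≤ r) (n : ℕ) :
    0 ≤ fibOrbit γ A h β p r n := by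
  induction n with
  | zero => exact hr
  | succ n ih =>
    rw [fibOrbit_succ]
    exact mul_nonneg (hh.2.2.2.2.1 _ (mem_Ici.2 (mul_nonneg hβ ih))) (norm_nonneg _)

lemma fibOrbit_mono (hh : GoodH h) (hβ : 0 ≤ β) (p : Θ × ℝ) {r s : ℝ} (hr : 0 ≤ r)
    (hrs : r ≤ s) (n : ℕ) : fibOrbit γ A h β p r n ≤ fibOrbit γ A h β p s n := by
  induction n with
  | zero => exact hrs
  | succ n ih =>
    rw [fibOrbit_succ, fibOrbit_succ]
    refine mul_le_mul_of_nonneg_right (hh.2.1.monotoneOn (mem_Ici.2 ?_) (mem_Ici.2 ?_) ?_)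
      (norm_nonneg _)
    · exact mul_nonneg hβ (fibOrbit_nonneg hh hβ p hr n)
    · exact mul_nonneg hβ (fibOrbit_nonneg hh hβ p (hr.trans hrs) n)
    · exact mul_le_mul_of_nonneg_left ih hβ

/-- An orbit started at `1` dominates, up to a constant, the growth of some tail of its linear
part. -/
lemma exists_mul_omegaProd_le_fibOrbit {s c : ℝ} (hs : 0 < s) (hβ : 0 ≤ β)
    (hh : GoodH h) (hmin : ∀ x, 0 ≤ x → min (s * x) c ≤ h (β * x)) (p : Θ × ℝ) (n : ℕ) :
    ∃ k q, (gMap γ A)^[k] q = (gMap γ A)^[n] p ∧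
      min 1 (c / s) * (s ^ k * OmegaProd γ A k q) ≤ fibOrbit γ A h β p 1 n := by
  have hΩ : ∀ k q, OmegaProd γ A (k + 1) q =
      OmegaProd γ A k q * Omega A ((gMap γ A)^[k] q) := fun k q => by
    simp [OmegaProd, Finset.prod_range_succ]
  induction n with
  | zero => exact ⟨0, p, rfl, by simp [OmegaProd, fibOrbit_zero]⟩
  | succ n ih =>
    obtain ⟨k, q, hq, hle⟩ := ih
    have h0 : 0 ≤ fibOrbit γ A h β p 1 n := fibOrbit_nonneg hh hβ p zero_le_one n
    have hω : 0 ≤ Omega A ((gMap γ A)^[n] p) := norm_nonneg _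
    have h1 := mul_le_mul_of_nonneg_right (hmin _ h0) hω
    rw [← fibOrbit_succ] at h1
    rcases min_choice (s * fibOrbit γ A h β p 1 n) c with hm | hm <;> rw [hm] at h1
    · refine ⟨k + 1, q, by rw [Function.iterate_succ_apply', hq, Function.iterate_succ_apply'],
        le_trans ?_ h1⟩
      rw [hΩ, hq]
      calc _ = s * (min 1 (c / s) * (s ^ k * OmegaProd γ A k q)) *
            Omega A ((gMap γ A)^[n] p) := by ring
        _ ≤ _ := by gcongr
    · refine ⟨1, (gMap γ A)^[n] p, (Function.iterate_succ_apply' _ _ _).symm, le_trans ?_ h1⟩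
      have h2 : min 1 (c / s) * s ≤ c := by
        calc _ ≤ c / s * s := by gcongr; exact min_le_right _ _
          _ = c := div_mul_cancel₀ _ hs.ne'
      calc _ = min 1 (c / s) * s * Omega A ((gMap γ A)^[n] p) := by
            simp [OmegaProd]; ring
        _ ≤ _ := by gcongr

lemma pullback1_eq_fibOrbit (n : ℕ) (p : Θ × ℝ) :
    pullback1 γ γinv A h β n p = fibOrbit γ A h β ((gInv γinv A)^[n] p) 1 n := rfl

/-- The pullback iterates intertwine with the double skew product. -/
lemma pullback1_succ_gMap (hdet : ∀ θ, (A θ).det = 1) (hγ : Function.LeftInverse γinv γ)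
    (hγ' : Function.RightInverse γinv γ) (n : ℕ) (p : Θ × ℝ) :
    pullback1 γ γinv A h β (n + 1) (gMap γ A p) =
      h (β * pullback1 γ γinv A h β n p) * Omega A p := by
  have h1 : SameLine ((gInv γinv A)^[n + 1] (gMap γ A p)) ((gInv γinv A)^[n] p) := by
    rw [Function.iterate_succ_apply]
    exact SameLine.iterate (fun _ _ h => h.gInv hdet) (sameLine_gInv_gMap hdet hγ p) n
  rw [pullback1_eq_fibOrbit, h1.fibOrbit_eq hdet, fibOrbit_succ,
    (sameLine_gMap_iterate_gInv_iterate hdet hγ' n p).omega_eq, ← pullback1_eq_fibOrbit]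

lemma pullback1_antitone (hdet : ∀ θ, (A θ).det = 1) (hγ : Function.RightInverse γinv γ)
    (hh : GoodH h) (hβ : 0 ≤ β) (hle : ∀ p, h β * Omega A p ≤ 1) (p : Θ × ℝ) :
    Antitone fun n => pullback1 γ γinv A h β n p := by
  refine antitone_nat_of_succ_le fun n => ?_
  rw [pullback1_eq_fibOrbit, fibOrbit_succ', Function.iterate_succ_apply',
    (sameLine_gMap_gInv hdet hγ _).fibOrbit_eq hdet, pullback1_eq_fibOrbit]
  refine fibOrbit_mono hh hβ _ (mul_nonneg (hh.2.2.2.2.1 _ ?_) (norm_nonneg _)) ?_ n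
  · simpa using hβ
  · rw [mul_one]
    exact hle _

/-- Above the critical parameter, orbits started at `1` stay uniformly away from `0`. -/
lemma exists_pos_le_fibOrbit {Θ : Type*} [MetricSpace Θ] [CompactSpace Θ] {γ : Θ → Θ}
    {A : Θ → Matrix (Fin 2) (Fin 2) ℝ} (hγ : Continuous γ) (hdet : ∀ θ, (A θ).det = 1)
    (hA : Continuous A) (hh : GoodH h) (hβ : Real.exp (lyapMax γ A) < β) :
    ∃ δ > 0, ∀ p n, δ ≤ fibOrbit γ A h β p 1 n := by
  obtain ⟨s, hs, hsβ⟩ := exists_between hβ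
  have hs0 : 0 < s := (Real.exp_pos _).trans hs
  have hβ0 : 0 < β := hs0.trans hsβ
  obtain ⟨C, hC, hCle⟩ := exists_opNorm_coc_le_mul_pow hγ hdet hA hs
  obtain ⟨c, hc, hmin⟩ := hh.exists_min_le ((div_lt_one hβ0).2 hsβ)
  refine ⟨min 1 (c / s) / C, by positivity, fun p n => ?_⟩
  obtain ⟨k, q, -, hle⟩ := exists_mul_omegaProd_le_fibOrbit (γ := γ) (A := A) hs0 hβ0.le hh
    (fun x hx => by
      have := hmin (β * x) (by positivity)
      rwa [← mul_assoc, div_mul_cancel₀ _ hβ0.ne'] at this) p n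
  refine le_trans ?_ hle
  rw [div_eq_mul_inv]
  gcongr
  rw [omegaProd_eq_norm hdet, inv_le_iff_one_le_mul₀ hC]
  calc (1 : ℝ) = ‖vHalf q.2‖ := (norm_vHalf _).symm
    _ ≤ opNorm (coc γ A k q.1) * ‖mulVecE (coc γ A k q.1) (vHalf q.2)‖ :=
      norm_le_opNorm_mul_norm_mulVecE (det_coc hdet k q.1) _
    _ ≤ C * s ^ k * ‖mulVecE (coc γ A k q.1) (vHalf q.2)‖ := by gcongr; exact hCle k q.1
    _ = _ := by ring

end Orbits

/-- If `β > β₂`, the upper bounding graph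
`ψ⁺_β(θ,α) = limₙ F^n_{β,g^{-n}(θ,α)}(1)` is globally attracting away from the zero
section: `F^n_{β,θ,α}(r) − ψ⁺_β(g^n(θ,α)) → 0` for every `r > 0`. -/
theorem stmt16 {Θ : Type*} [MetricSpace Θ] [CompactSpace Θ]
    (γ : Θ ≃ₜ Θ)
    (A : Θ → Matrix (Fin 2) (Fin 2) ℝ) (hdet : ∀ θ, (A θ).det = 1) (hA : Continuous A)
    (h : ℝ → ℝ) (hh : GoodH h) (hscale : Scaled A h)
    (β : ℝ) (hβ : Real.exp (lyapMax ⇑γ A) < β) :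
    ∃ ψ : Θ × ℝ → ℝ,
      (∀ θ : Θ, ∀ α : ℝ,
        Filter.Tendsto (fun n : ℕ => pullback1 ⇑γ ⇑γ.symm A h β n (θ, α))
          Filter.atTop (𝓝 (ψ (θ, α)))) ∧
      ∀ θ : Θ, ∀ α : ℝ, ∀ r : ℝ, 0 < r →
        Filter.Tendsto
          (fun n : ℕ =>
            ((dsMap ⇑γ A h β)^[n] (θ, α, r)).2.2 - ψ ((gMap ⇑γ A)^[n] (θ, α)))
          Filter.atTop (𝓝 0) := by
  obtain ⟨δ, hδ, hlow⟩ := exists_pos_le_fibOrbit γ.continuous hdet hA hh hβ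
  have hβ0 : 0 < β := (Real.exp_pos _).trans hβ
  have hω := omega_pos (A := A) hdet
  set ψ : Θ × ℝ → ℝ := fun p => ⨅ n, pullback1 γ γ.symm A h β n p
  have hlim : ∀ p, Tendsto (fun n => pullback1 γ γ.symm A h β n p) atTop (𝓝 (ψ p)) := fun p =>
    tendsto_atTop_ciInf
      (pullback1_antitone hdet γ.right_inv hh hβ0.le
        (fun q => hscale.mul_omega_le_one hdet hA hβ0.le q) p)
      ⟨δ, by rintro _ ⟨n, rfl⟩; exact hlow _ n⟩
  refine ⟨ψ, fun θ α => hlim (θ, α), fun θ α r hr => ?_⟩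
  have hψδ : ∀ p, δ ≤ ψ p := fun p => ge_of_tendsto' (hlim p) fun n => hlow _ n
  have hψpos : ∀ p, 0 < ψ p := fun p => hδ.trans_le (hψδ p)
  have hinv : ∀ p, ψ (gMap γ A p) = h (β * ψ p) * Omega A p := by
    intro p
    refine tendsto_nhds_unique ((tendsto_add_atTop_iff_nat 1).2 (hlim (gMap γ A p))) ?_
    refine Tendsto.congr
      (fun n => (pullback1_succ_gMap hdet γ.left_inv γ.right_inv n p).symm) ?_
    refine Tendsto.mul_const _ ?_
    exact (hh.continuousOn.continuousAt (Ici_mem_nhds (mul_pos hβ0 (hψpos p)))).tendsto.comp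
      ((hlim p).const_mul β)
  set p : Θ × ℝ := (θ, α)
  have hψ1 : ∀ q, ψ q ≤ 1 := fun q =>
    ciInf_le (f := fun n => pullback1 γ γ.symm A h β n q)
      ⟨δ, by rintro _ ⟨n, rfl⟩; exact hlow _ n⟩ 0
  have hstep : ∀ n, ψ ((gMap γ A)^[n + 1] p) =
      h (β * ψ ((gMap γ A)^[n] p)) * Omega A ((gMap γ A)^[n] p) := fun n => by
    rw [Function.iterate_succ_apply', hinv]
  change Tendsto (fun n => fibOrbit γ A h β p r n - ψ ((gMap γ A)^[n] p)) atTop (𝓝 0)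
  rcases le_total r (ψ p) with hrψ | hrψ
  · simpa using (hh.tendsto_sub_of_le (b := fun n => ψ ((gMap γ A)^[n] p)) hβ0 (fun n => hω ((gMap γ A)^[n] p))
      (fibOrbit_succ p r) hstep hr hrψ (fun n => hψ1 _)).neg
  · refine hh.tendsto_sub_of_le (a := fun n => ψ ((gMap γ A)^[n] p)) (B := max r 1) hβ0 (fun n => hω ((gMap γ A)^[n] p))
      hstep (fibOrbit_succ p r) (hψpos p) hrψ (fun n => ?_)
    cases n with
    | zero => exact le_max_left _ _
    | succ n =>
      rw [fibOrbit_succ]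
      exact (hscale.mul_omega_le_one hdet hA
        (mul_nonneg hβ0.le (fibOrbit_nonneg hh hβ0.le p hr.le n)) _).trans (le_max_right _ _)
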